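/- There exists a constant C > 0 such that for every z₀ ∈ ℝ⁴ and every measurable function f : ℝ³ → [0,∞], ∫_{ℝ⁴} f(K(y))·‖y − z₀‖^{−2} dy = C · ∫_{ℝ³} f(x)·(‖x‖·‖x − K(z₀)‖)^{−1} dx, with both Lebesgue integrals taking values in [0,∞]. -/

import Mathlib

open MeasureTheory

/-- The Hopf (Kustaanheimo–Stiefel) map `K : ℝ⁴ → ℝ³`,
`K(z₀,z₁,z₂,z₃) = (z₀² − z₁² − z₂² + z₃², 2z₀z₁ − 2z₂z₃, 2z₀z₂ + 2z₁z₃)`. -/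
noncomputable def hopfKS (z : EuclideanSpace ℝ (Fin 4)) : EuclideanSpace ℝ (Fin 3) :=
  (WithLp.equiv 2 (Fin 3 → ℝ)).symm
    ![z 0 ^ 2 - z 1 ^ 2 - z 2 ^ 2 + z 3 ^ 2,
      2 * z 0 * z 1 - 2 * z 2 * z 3,
      2 * z 0 * z 2 + 2 * z 1 * z 3]

namespace HopfKS

open Complex Set
open scoped Real ENNReal ComplexConjugate

/-- The angular integral of `1 / (A - 2 Re (e^{iθ} c))`, from the Poisson integral formula. -/
lemma lintegral_inv_sub_two_mul_re_exp_mul {A : ℝ} {c : ℂ} (h : 2 * ‖c‖ < A) :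
    ∫⁻ θ in Ioo (-π) π, ENNReal.ofReal (A - 2 * (exp (θ * I) * c).re)⁻¹ =
      ENNReal.ofReal (2 * π / √(A ^ 2 - 4 * ‖c‖ ^ 2)) := by
  have hc := norm_nonneg c
  have hA : 0 < A := by linarith
  have hD : 0 < A ^ 2 - 4 * ‖c‖ ^ 2 := by nlinarith
  set s := √(A ^ 2 - 4 * ‖c‖ ^ 2) with hs
  have hs0 : 0 < s := Real.sqrt_pos.2 hD
  have hs2 : s ^ 2 = A ^ 2 - 4 * ‖c‖ ^ 2 := Real.sq_sqrt hD.le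
  set p : ℝ := (A + s) / 2 with hp
  have hp0 : 0 < p := by positivity
  set q : ℂ := conj c / p with hq
  have hqn : ‖q‖ = ‖c‖ / p := by simp [hq, abs_of_pos hp0]
  have hq1 : ‖q‖ < 1 := by
    rw [hqn, div_lt_one hp0]; simp only [hp]; linarith
  have hpq : p * (1 - ‖q‖ ^ 2) = s := by
    rw [hqn]; field_simp; simp only [hp]; nlinarith
  have key : ∀ θ : ℝ, (A - 2 * (exp (θ * I) * c).re)⁻¹ =
      s⁻¹ * ((‖circleMap 0 1 θ - 0‖ ^ 2 - ‖q - 0‖ ^ 2) /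
        ‖(circleMap 0 1 θ - 0) - (q - 0)‖ ^ 2) := by
    intro θ
    have e1 : ‖circleMap 0 1 θ‖ = 1 := by simp
    have e2 : A - 2 * (exp (θ * I) * c).re = p * ‖circleMap 0 1 θ - q‖ ^ 2 := by
      have hcp : c = p * conj q := by
        have : (p : ℂ) ≠ 0 := by exact_mod_cast hp0.ne'
        simp only [hq, map_div₀, conj_conj, conj_ofReal]; field_simp
      have hA' : A = p * (1 + ‖q‖ ^ 2) := by
        have : A = 2 * p - s := by simp only [hp]; ring
        rw [this, ← hpq]; ring
      have e3 : ‖circleMap 0 1 θ - q‖ ^ 2 =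
          1 + ‖q‖ ^ 2 - 2 * (circleMap 0 1 θ * conj q).re := by
        rw [← normSq_eq_norm_sq, normSq_sub, normSq_eq_norm_sq, normSq_eq_norm_sq, e1]; ring
      have e4 : (exp (θ * I) * c).re = p * (circleMap 0 1 θ * conj q).re := by
        rw [← re_ofReal_mul]
        congr 1
        nth_rewrite 1 [hcp]
        simp [circleMap]; ring
      rw [e3, e4]; nth_rewrite 1 [hA']; ring
    have e5 : 0 < ‖circleMap 0 1 θ - q‖ := by
      rw [norm_pos_iff, sub_ne_zero]
      intro h'; rw [← h', e1] at hq1; exact lt_irrefl _ hq1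
    have hq2 : 0 < 1 - ‖q‖ ^ 2 := by nlinarith [norm_nonneg q]
    rw [e2, sub_zero, sub_zero, e1, ← hpq]
    field_simp
  have hpos : ∀ θ : ℝ, 0 < A - 2 * (exp (θ * I) * c).re := by
    intro θ
    have h1 : (exp (θ * I) * c).re ≤ ‖c‖ := by
      simpa [norm_exp_ofReal_mul_I] using re_le_norm (exp (θ * I) * c)
    linarith
  have hcont : Continuous fun θ : ℝ => (A - 2 * (exp (θ * I) * c).re)⁻¹ :=
    Continuous.inv₀ (by fun_prop) fun θ => (hpos θ).ne'
  have hper : Function.Periodic (fun θ : ℝ => (A - 2 * (exp (θ * I) * c).re)⁻¹) (2 * π) := by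
    intro θ
    simp only [ofReal_add, ofReal_mul, ofReal_ofNat, add_mul, exp_add, exp_two_pi_mul_I, mul_one]
  have hav := (InnerProductSpace.harmonicOnNhd_const (1 : ℝ)
    (s := Metric.closedBall (0 : ℂ) 1)).circleAverage_poissonKernel_smul (w := q)
    (by simpa using hq1)
  have hval : ∫ θ in (-π)..π, (A - 2 * (exp (θ * I) * c).re)⁻¹ = 2 * π / s := by
    have h1 := hper.intervalIntegral_add_eq (-π) 0
    rw [zero_add, show -π + 2 * π = π by ring] at h1
    rw [h1]
    simp_rw [key]
    rw [intervalIntegral.integral_const_mul]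
    rw [Real.circleAverage_def] at hav
    simp only [Pi.smul_apply', smul_eq_mul, mul_one, poissonKernel_def] at hav
    rw [inv_mul_eq_iff_eq_mul₀ (by positivity)] at hav
    rw [hav]; field_simp
  rw [← hval, intervalIntegral.integral_of_le (by linarith [Real.pi_pos]),
    integral_Ioc_eq_integral_Ioo, ofReal_integral_eq_lintegral_ofReal]
  · exact (hcont.integrableOn_Icc (a := -π) (b := π)).mono_set Ioo_subset_Icc_self
  · exact .of_forall fun θ => (inv_pos.2 (hpos θ)).le

/-- Change of variables `t = r ^ 2 - (ρ / (2 r)) ^ 2` from `(0, ∞)` onto `ℝ`. -/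
lemma lintegral_Ioi_inv_mul_comp_sq_sub {ρ : ℝ} (hρ : 0 < ρ) (g : ℝ → ℝ≥0∞) :
    ∫⁻ r in Ioi (0 : ℝ), ENNReal.ofReal r⁻¹ * g (r ^ 2 - (ρ / (2 * r)) ^ 2) =
      ∫⁻ t, ENNReal.ofReal (2 * √(t ^ 2 + ρ ^ 2))⁻¹ * g t := by
  set φ : ℝ → ℝ := fun r => r ^ 2 - (ρ / (2 * r)) ^ 2 with hφ
  have hsq : ∀ r ∈ Ioi (0 : ℝ), √(φ r ^ 2 + ρ ^ 2) = r ^ 2 + (ρ / (2 * r)) ^ 2 := by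
    intro r hr
    have hr : 0 < r := hr
    rw [Real.sqrt_eq_iff_mul_self_eq (by positivity) (by positivity)]
    simp only [hφ]; field_simp; ring
  have hderiv : ∀ r ∈ Ioi (0 : ℝ),
      HasDerivWithinAt φ (2 / r * (r ^ 2 + (ρ / (2 * r)) ^ 2)) (Ioi 0) r := by
    intro r hr
    have hr : 0 < r := hr
    have h1 := ((hasDerivAt_id r).pow 2).sub
      ((((hasDerivAt_id r).const_mul 2).fun_inv (by simp [hr.ne'])).const_mul ρ |>.pow 2)
    refine (h1.congr_deriv ?_).hasDerivWithinAt.congr_of_eventuallyEq ?_ ?_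
    · simp; field_simp; ring
    · filter_upwards with x; simp [hφ, div_eq_mul_inv]
    · simp [hφ, div_eq_mul_inv]
  have hmono : StrictMonoOn φ (Ioi 0) := by
    intro x hx y hy hxy
    have hx : 0 < x := hx
    have hy : 0 < y := hy
    have h1 : x ^ 2 < y ^ 2 := by gcongr
    have h2 : (ρ / (2 * y)) ^ 2 ≤ (ρ / (2 * x)) ^ 2 := by gcongr
    simp only [hφ]; linarith
  have himage : φ '' Ioi 0 = univ := by
    refine eq_univ_of_forall fun t => ?_
    have hlt : |t| < √(t ^ 2 + ρ ^ 2) := by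
      rw [← Real.sqrt_sq_eq_abs]
      exact Real.sqrt_lt_sqrt (sq_nonneg t) (by nlinarith)
    have hu : 0 < (t + √(t ^ 2 + ρ ^ 2)) / 2 := by
      have := neg_abs_le t; linarith
    refine ⟨√((t + √(t ^ 2 + ρ ^ 2)) / 2), Real.sqrt_pos.2 hu, ?_⟩
    have hs2 := Real.sq_sqrt (show 0 ≤ t ^ 2 + ρ ^ 2 by positivity)
    simp only [hφ, div_pow, mul_pow]
    rw [Real.sq_sqrt hu.le]
    set s := √(t ^ 2 + ρ ^ 2)
    have hne : t + s ≠ 0 := by intro h; rw [h] at hu; simp at hu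
    field_simp
    linear_combination hs2
  have h := lintegral_image_eq_lintegral_abs_deriv_mul measurableSet_Ioi hderiv
    hmono.injOn
    (fun t => ENNReal.ofReal (2 * √(t ^ 2 + ρ ^ 2))⁻¹ * g t)
  rw [himage, setLIntegral_univ] at h
  rw [h]
  refine setLIntegral_congr_fun measurableSet_Ioi fun r hr => ?_
  rw [← mul_assoc, ← ENNReal.ofReal_mul (abs_nonneg _), hsq r hr]
  have hr : 0 < r := hr
  congr 2
  rw [abs_of_pos (by positivity)]
  field_simp

lemma lintegral_eq_mul_lintegral_div {c : ℂ} (hc : c ≠ 0) (g : ℂ → ℝ≥0∞) :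
    ∫⁻ z, g z = ENNReal.ofReal (‖c‖ ^ 2)⁻¹ * ∫⁻ w, g (w / c) := by
  have hdet : LinearMap.det (LinearMap.mulLeft ℝ c) = ‖c‖ ^ 2 := by
    have := Algebra.norm_complex_apply c
    rw [Algebra.norm_apply] at this
    rw [← normSq_eq_norm_sq, ← this]; rfl
  have hmap := Measure.map_linearMap_addHaar_eq_smul_addHaar (volume : Measure ℂ)
    (f := LinearMap.mulLeft ℝ c) (by rw [hdet]; positivity)
  rw [hdet, abs_of_nonneg (by positivity)] at hmap
  rw [← smul_eq_mul, ← lintegral_smul_measure, ← hmap]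
  change _ = ∫⁻ w, g (w / c) ∂(Measure.map (MeasurableEquiv.mulLeft₀ c hc) volume)
  rw [lintegral_map_equiv]
  refine lintegral_congr fun z => ?_
  rw [MeasurableEquiv.coe_mulLeft₀, mul_div_cancel_left₀ z hc]

lemma norm_sub_sq_add_norm_sub_sq (a b w : ℂ) {r : ℝ} (hr : 0 < r) (θ : ℝ) :
    ‖r * exp (θ * I) - a‖ ^ 2 + ‖w / (2 * (r * exp (θ * I))) - b‖ ^ 2 =
      r ^ 2 + (‖w‖ / (2 * r)) ^ 2 + ‖a‖ ^ 2 + ‖b‖ ^ 2 -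
        2 * (exp (θ * I) * (r * conj a + conj w / (2 * r) * b)).re := by
  have hr' : (r : ℂ) ≠ 0 := by exact_mod_cast hr.ne'
  have h1 : ‖(r : ℂ) * exp (θ * I)‖ = r := by
    rw [norm_mul, norm_exp_ofReal_mul_I, mul_one, norm_real, Real.norm_of_nonneg hr.le]
  have hconj : conj (exp (θ * I)) = (exp (θ * I))⁻¹ := by
    rw [← exp_conj, ← exp_neg]; simp
  have h2 : conj (w / (2 * (r * exp (θ * I)))) = exp (θ * I) * (conj w / (2 * r)) := by
    simp only [map_div₀, map_mul, hconj, conj_ofReal, map_ofNat]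
    field_simp [exp_ne_zero]
  have h3 : (w / (2 * (r * exp (θ * I))) * conj b).re =
      (exp (θ * I) * (conj w / (2 * r)) * b).re := by
    rw [← h2, ← conj_re]; simp
  rw [← normSq_eq_norm_sq, ← normSq_eq_norm_sq, normSq_sub, normSq_sub, h3]
  simp only [normSq_eq_norm_sq, norm_div, norm_mul (2 : ℂ), h1, Complex.norm_ofNat]
  simp only [mul_add, add_re, ← mul_assoc, mul_comm (r : ℂ)]
  ring_nf

/-- The Hopf map distorts distances as
`‖K y - K z‖ ^ 2 = (‖y‖ ^ 2 + ‖z‖ ^ 2) ^ 2 - 4 * |⟪y, z⟫_ℂ| ^ 2`. -/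
lemma sq_sub_four_mul_norm_sq (a b w : ℂ) {r : ℝ} (hr : 0 < r) :
    (r ^ 2 + (‖w‖ / (2 * r)) ^ 2 + ‖a‖ ^ 2 + ‖b‖ ^ 2) ^ 2 -
        4 * ‖r * conj a + conj w / (2 * r) * b‖ ^ 2 =
      (r ^ 2 - (‖w‖ / (2 * r)) ^ 2 - (‖a‖ ^ 2 - ‖b‖ ^ 2)) ^ 2 + ‖w - 2 * a * b‖ ^ 2 := by
  have hr' : (r : ℂ) ≠ 0 := by exact_mod_cast hr.ne'
  obtain ⟨u, rfl⟩ : ∃ u, w = 2 * r * u := ⟨w / (2 * r), by field_simp⟩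
  have h1 : ‖2 * r * u‖ / (2 * r) = ‖u‖ := by
    simp [abs_of_pos hr]; field_simp
  have h2 : conj (2 * r * u) / (2 * r) = conj u := by
    rw [map_mul, map_mul, conj_ofReal, map_ofNat]; field_simp
  rw [h1, h2]
  simp only [← normSq_eq_norm_sq, normSq_apply]
  simp
  ring

/-- Integration over `{(α, β) | 2αβ = w}`, parametrized by `α`. -/
lemma lintegral_fiber (F : ℝ × ℂ → ℝ≥0∞) (hF : Measurable F) (a b : ℂ) {w : ℂ} (hw : w ≠ 0)
    (hw' : w ≠ 2 * a * b) :
    ∫⁻ α : ℂ, ENNReal.ofReal (‖2 * α‖ ^ 2)⁻¹ * (F (‖α‖ ^ 2 - ‖w / (2 * α)‖ ^ 2, w) *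
        ENNReal.ofReal (‖α - a‖ ^ 2 + ‖w / (2 * α) - b‖ ^ 2)⁻¹) =
      ENNReal.ofReal (π / 4) * ∫⁻ t, F (t, w) * ENNReal.ofReal (√(t ^ 2 + ‖w‖ ^ 2) *
        √((t - (‖a‖ ^ 2 - ‖b‖ ^ 2)) ^ 2 + ‖w - 2 * a * b‖ ^ 2))⁻¹ := by
  have hw0 : 0 < ‖w‖ := norm_pos_iff.2 hw
  have hw1 : 0 < ‖w - 2 * a * b‖ := norm_pos_iff.2 (sub_ne_zero.2 hw')
  set T : ℝ := ‖a‖ ^ 2 - ‖b‖ ^ 2 with hT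
  rw [← Complex.lintegral_comp_polarCoord_symm, polarCoord_target, Measure.volume_eq_prod,
    setLIntegral_prod _ (by
      simp only [Complex.polarCoord_symm_apply]
      fun_prop)]
  have hangle : ∀ r ∈ Ioi (0 : ℝ), (∫⁻ θ in Ioo (-π) π, ENNReal.ofReal r •
      (ENNReal.ofReal (‖2 * Complex.polarCoord.symm (r, θ)‖ ^ 2)⁻¹ *
        (F (‖Complex.polarCoord.symm (r, θ)‖ ^ 2 -
            ‖w / (2 * Complex.polarCoord.symm (r, θ))‖ ^ 2, w) *
          ENNReal.ofReal (‖Complex.polarCoord.symm (r, θ) - a‖ ^ 2 +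
            ‖w / (2 * Complex.polarCoord.symm (r, θ)) - b‖ ^ 2)⁻¹))) =
      ENNReal.ofReal r⁻¹ * (F (r ^ 2 - (‖w‖ / (2 * r)) ^ 2, w) * ENNReal.ofReal
        (π / 2 / √((r ^ 2 - (‖w‖ / (2 * r)) ^ 2 - T) ^ 2 + ‖w - 2 * a * b‖ ^ 2))) := by
    intro r hr
    have hr : 0 < r := hr
    have hkey := sq_sub_four_mul_norm_sq a b w hr
    rw [← hT] at hkey
    set c : ℂ := r * conj a + conj w / (2 * r) * b
    set A : ℝ := r ^ 2 + (‖w‖ / (2 * r)) ^ 2 + ‖a‖ ^ 2 + ‖b‖ ^ 2 with hA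
    have hA0 : 0 ≤ A := by positivity
    have hAc : 2 * ‖c‖ < A := by
      have : 0 < A ^ 2 - 4 * ‖c‖ ^ 2 := by rw [hkey]; positivity
      nlinarith [norm_nonneg c]
    have hθ : ∀ θ : ℝ, ENNReal.ofReal r •
      (ENNReal.ofReal (‖2 * Complex.polarCoord.symm (r, θ)‖ ^ 2)⁻¹ *
        (F (‖Complex.polarCoord.symm (r, θ)‖ ^ 2 -
            ‖w / (2 * Complex.polarCoord.symm (r, θ))‖ ^ 2, w) *
          ENNReal.ofReal (‖Complex.polarCoord.symm (r, θ) - a‖ ^ 2 +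
            ‖w / (2 * Complex.polarCoord.symm (r, θ)) - b‖ ^ 2)⁻¹)) =
        ENNReal.ofReal (4 * r)⁻¹ * F (r ^ 2 - (‖w‖ / (2 * r)) ^ 2, w) *
          ENNReal.ofReal (A - 2 * (exp (θ * I) * c).re)⁻¹ := by
      intro θ
      have h1 : Complex.polarCoord.symm (r, θ) = r * exp (θ * I) := by
        rw [Complex.polarCoord_symm_apply, exp_mul_I, ofReal_cos, ofReal_sin]
      rw [h1, norm_sub_sq_add_norm_sub_sq a b w hr θ]
      have h2 : ‖(r : ℂ) * exp (θ * I)‖ = r := by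
        rw [norm_mul, norm_exp_ofReal_mul_I, mul_one, norm_real, Real.norm_of_nonneg hr.le]
      simp only [norm_div, norm_mul (2 : ℂ), h2, Complex.norm_ofNat]
      rw [smul_eq_mul, ← mul_assoc, ← mul_assoc, ← ENNReal.ofReal_mul hr.le]
      congr 4
      field_simp; norm_num
    simp_rw [hθ]
    rw [lintegral_const_mul _ (by fun_prop), lintegral_inv_sub_two_mul_re_exp_mul hAc, hkey]
    rw [mul_comm (ENNReal.ofReal _) (F _), mul_assoc, mul_left_comm (ENNReal.ofReal _) (F _),
      ← ENNReal.ofReal_mul (by positivity), ← ENNReal.ofReal_mul (by positivity)]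
    congr 2
    field_simp; norm_num
  rw [setLIntegral_congr_fun measurableSet_Ioi hangle,
    lintegral_Ioi_inv_mul_comp_sq_sub hw0 (fun t => F (t, w) * ENNReal.ofReal
        (π / 2 / √((t - T) ^ 2 + ‖w - 2 * a * b‖ ^ 2))),
    ← lintegral_const_mul' _ _ ENNReal.ofReal_ne_top]
  refine lintegral_congr fun t => ?_
  rw [mul_left_comm, mul_left_comm (ENNReal.ofReal _) (F _),
    ← ENNReal.ofReal_mul (by positivity), ← ENNReal.ofReal_mul (by positivity)]
  congr 2
  field_simp; norm_num

lemma lintegral_complex_prod (F : ℝ × ℂ → ℝ≥0∞) (hF : Measurable F) (a b : ℂ) :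
    ∫⁻ p : ℂ × ℂ, F (‖p.1‖ ^ 2 - ‖p.2‖ ^ 2, 2 * p.1 * p.2) *
        ENNReal.ofReal (‖p.1 - a‖ ^ 2 + ‖p.2 - b‖ ^ 2)⁻¹ =
      ENNReal.ofReal (π / 4) * ∫⁻ q : ℝ × ℂ, F q * ENNReal.ofReal (√(q.1 ^ 2 + ‖q.2‖ ^ 2) *
        √((q.1 - (‖a‖ ^ 2 - ‖b‖ ^ 2)) ^ 2 + ‖q.2 - 2 * a * b‖ ^ 2))⁻¹ := by
  rw [Measure.volume_eq_prod, lintegral_prod _ (by fun_prop), Measure.volume_eq_prod,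
    lintegral_prod_symm _ (by fun_prop), ← lintegral_const_mul' _ _ ENNReal.ofReal_ne_top]
  have h1 : ∀ᵐ α : ℂ, ∫⁻ β : ℂ, F (‖α‖ ^ 2 - ‖β‖ ^ 2, 2 * α * β) *
        ENNReal.ofReal (‖α - a‖ ^ 2 + ‖β - b‖ ^ 2)⁻¹ =
      ∫⁻ w : ℂ, ENNReal.ofReal (‖2 * α‖ ^ 2)⁻¹ * (F (‖α‖ ^ 2 - ‖w / (2 * α)‖ ^ 2, w) *
        ENNReal.ofReal (‖α - a‖ ^ 2 + ‖w / (2 * α) - b‖ ^ 2)⁻¹) := by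
    filter_upwards [Measure.ae_ne volume 0] with α hα
    have h2α : 2 * α ≠ 0 := mul_ne_zero two_ne_zero hα
    rw [lintegral_eq_mul_lintegral_div h2α _, ← lintegral_const_mul' _ _ ENNReal.ofReal_ne_top]
    simp_rw [mul_div_cancel₀ _ h2α]
  rw [lintegral_congr_ae h1, lintegral_lintegral_swap (by fun_prop)]
  refine lintegral_congr_ae ?_
  filter_upwards [Measure.ae_ne volume 0, Measure.ae_ne volume (2 * a * b)] with w hw hw'
  exact lintegral_fiber F hF a b hw hw'

/-- The identification of `ℂ²` with `ℝ⁴` for which `hopfKS` is `(α, β) ↦ (|α|² - |β|², 2αβ)`. -/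
noncomputable def complexProdEquiv : WithLp 2 (ℂ × ℂ) ≃ₗᵢ[ℝ] EuclideanSpace ℝ (Fin 4) where
  toFun p := !₂[p.fst.re, p.snd.re, p.snd.im, p.fst.im]
  invFun y := WithLp.toLp 2 (⟨y 0, y 3⟩, ⟨y 1, y 2⟩)
  map_add' p q := by ext i; fin_cases i <;> simp
  map_smul' c p := by ext i; fin_cases i <;> simp
  left_inv _ := rfl
  right_inv y := by ext i; fin_cases i <;> simp
  norm_map' p := by
    change ‖!₂[p.fst.re, p.snd.re, p.snd.im, p.fst.im]‖ = _
    rw [EuclideanSpace.norm_eq, WithLp.prod_norm_eq_of_L2]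
    congr 1
    simp [Fin.sum_univ_four, ← normSq_eq_norm_sq, normSq_apply]
    ring

/-- The identification of `ℝ × ℂ` with `ℝ³`. -/
noncomputable def realComplexEquiv : WithLp 2 (ℝ × ℂ) ≃ₗᵢ[ℝ] EuclideanSpace ℝ (Fin 3) where
  toFun p := !₂[p.fst, p.snd.re, p.snd.im]
  invFun x := WithLp.toLp 2 (x 0, ⟨x 1, x 2⟩)
  map_add' p q := by ext i; fin_cases i <;> simp
  map_smul' c p := by ext i; fin_cases i <;> simp
  left_inv _ := rfl
  right_inv y := by ext i; fin_cases i <;> simp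
  norm_map' p := by
    change ‖!₂[p.fst, p.snd.re, p.snd.im]‖ = _
    rw [EuclideanSpace.norm_eq, WithLp.prod_norm_eq_of_L2]
    congr 1
    simp [Fin.sum_univ_three, ← normSq_eq_norm_sq, normSq_apply]
    ring

lemma complexProdEquiv_apply (p : WithLp 2 (ℂ × ℂ)) :
    complexProdEquiv p = !₂[p.fst.re, p.snd.re, p.snd.im, p.fst.im] := rfl

lemma realComplexEquiv_apply (p : WithLp 2 (ℝ × ℂ)) :
    realComplexEquiv p = !₂[p.fst, p.snd.re, p.snd.im] := rfl

lemma hopfKS_complexProdEquiv (α β : ℂ) :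
    hopfKS (complexProdEquiv (WithLp.toLp 2 (α, β))) =
      realComplexEquiv (WithLp.toLp 2 (‖α‖ ^ 2 - ‖β‖ ^ 2, 2 * α * β)) := by
  ext i
  fin_cases i <;>
    simp [hopfKS, complexProdEquiv_apply, realComplexEquiv_apply, ← normSq_eq_norm_sq, normSq_apply] <;>
    ring

lemma measurable_hopfKS : Measurable hopfKS := by
  refine Continuous.measurable ?_
  refine (PiLp.continuous_toLp 2 _).comp (continuous_pi fun i => ?_)
  fin_cases i <;> simp <;> fun_prop

lemma measurePreserving_complexProdEquiv :
    MeasurePreserving fun p : ℂ × ℂ => complexProdEquiv (WithLp.toLp 2 p) :=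
  complexProdEquiv.measurePreserving.comp (WithLp.volume_preserving_toLp ℂ ℂ)

lemma measurePreserving_realComplexEquiv :
    MeasurePreserving fun p : ℝ × ℂ => realComplexEquiv (WithLp.toLp 2 p) :=
  realComplexEquiv.measurePreserving.comp (WithLp.volume_preserving_toLp ℝ ℂ)

end HopfKS

/-- There is a constant `C > 0` such that for every `z₀ ∈ ℝ⁴` and every measurable
`f : ℝ³ → [0,∞]`,
`∫_{ℝ⁴} f(K(y))·‖y − z₀‖⁻² dy = C·∫_{ℝ³} f(x)·(‖x‖·‖x − K(z₀)‖)⁻¹ dx`. -/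
theorem lintegral_hopfKS_potential :
    ∃ C : ℝ, 0 < C ∧
      ∀ (z₀ : EuclideanSpace ℝ (Fin 4)) (f : EuclideanSpace ℝ (Fin 3) → ENNReal),
        Measurable f →
          ∫⁻ y, f (hopfKS y) * ENNReal.ofReal (‖y - z₀‖ ^ 2)⁻¹ =
            ENNReal.ofReal C *
              ∫⁻ x, f x * ENNReal.ofReal (‖x‖ * ‖x - hopfKS z₀‖)⁻¹ := by
  refine ⟨Real.pi / 4, by positivity, fun z₀ f hf => ?_⟩
  obtain ⟨p₀, rfl⟩ := HopfKS.complexProdEquiv.surjective z₀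
  obtain ⟨⟨a, b⟩, rfl⟩ := (WithLp.toLp_surjective 2) p₀
  have hK := HopfKS.measurable_hopfKS
  rw [← HopfKS.measurePreserving_complexProdEquiv.lintegral_comp (by fun_prop),
    ← HopfKS.measurePreserving_realComplexEquiv.lintegral_comp (by fun_prop)]
  have h := HopfKS.lintegral_complex_prod
    (fun q => f (HopfKS.realComplexEquiv (WithLp.toLp 2 q)))
    (hf.comp HopfKS.measurePreserving_realComplexEquiv.measurable) a b
  refine (lintegral_congr fun p => ?_).trans
    (h.trans (congrArg _ (lintegral_congr fun q => ?_).symm))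
  · rw [HopfKS.hopfKS_complexProdEquiv p.1 p.2, ← map_sub, LinearIsometryEquiv.norm_map,
      WithLp.prod_norm_sq_eq_of_L2]
    rfl
  · rw [HopfKS.hopfKS_complexProdEquiv, ← map_sub, LinearIsometryEquiv.norm_map,
      LinearIsometryEquiv.norm_map, WithLp.prod_norm_eq_of_L2, WithLp.prod_norm_eq_of_L2]
    simp
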